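/- Conservation of linear invariants by relaxed partitioned (multirate) explicit Runge-Kutta methods with a shared weight vector: if q : Fin M → ℝ satisfies ⟪q, F t V⟫ = 0 (Euclidean inner product) for every t ∈ ℝ and every V : Fin M → ℝ, then ⟪q, U(γ)⟫ = ⟪q, Uₙ⟫ for every relaxation parameter γ ∈ ℝ. -/

import Mathlib

open Finset

/-- Conservation of linear invariants by relaxed partitioned (multirate)
explicit Runge-Kutta methods with a shared weight vector. -/
theorem relaxed_PRK_conserves_linear_invariants
    (S M R : ℕ) (hS : 1 ≤ S) (hM : 1 ≤ M) (hR : 1 ≤ R)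
    (p : Fin M → Fin R)
    (a : Fin R → Fin S → Fin S → ℝ) (b c : Fin S → ℝ)
    (ha : ∀ (r : Fin R) (i j : Fin S), i ≤ j → a r i j = 0)
    (F : ℝ → (Fin M → ℝ) → (Fin M → ℝ))
    (Uₙ : Fin M → ℝ) (tₙ Δt : ℝ) (hΔt : 0 < Δt)
    (K : Fin R → Fin S → (Fin M → ℝ))
    (hK : ∀ (r : Fin R) (i : Fin S),
      K r i = fun m =>
        if p m = r then
          F (tₙ + c i * Δt)
            (Uₙ + Δt • ∑ j ∈ Finset.univ.filter (fun j => j < i),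
              ∑ k, a k i j • K k j) m
        else 0)
    (q : Fin M → ℝ)
    (hq : ∀ (t : ℝ) (V : Fin M → ℝ), ∑ m, q m * F t V m = 0) :
    ∀ γ : ℝ,
      ∑ m, q m * (Uₙ + γ • Δt • ∑ i, b i • (∑ r, K r i)) m =
        ∑ m, q m * Uₙ m := by
  intro γ
  have stage (i : Fin S) : q ⬝ᵥ ∑ r, K r i = 0 := by
    have sum_stages : ∑ r, K r i =
        F (tₙ + c i * Δt)
          (Uₙ + Δt • ∑ j ∈ Finset.univ.filter (fun j => j < i), ∑ k, a k i j • K k j) := by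
      rw [Finset.sum_congr rfl fun r _ => hK r i]
      ext m
      simp only [Finset.sum_apply, Finset.sum_ite_eq, Finset.mem_univ, if_true]
    rw [sum_stages]
    exact hq _ _
  change q ⬝ᵥ (Uₙ + γ • Δt • ∑ i, b i • ∑ r, K r i) = q ⬝ᵥ Uₙ
  simp only [dotProduct_add, dotProduct_smul, dotProduct_sum _ (Finset.univ : Finset (Fin S)),
    stage, smul_zero, Finset.sum_const_zero, add_zero]
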